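/- Let n, m be positive integers, k a weight vector with k₁ ≥ k₂ ≥ … ≥ kₙ, let 1 ≤ t ≤ n−1, λ ≥ 1, 0 < γ < 1, and let Θ be an n×m real matrix such that max_{1≤i≤n} |u_i|^{1/(m k_i)} · max_{1≤j≤m} ‖Θ*_j(u)‖ > γ for all nonzero u ∈ ℤⁿ. Then for every T ≥ 1 there exists (u,v) ∈ ℤⁿ × ℤ^m such that: |u_i| ≤ T^{m k_i} for 1 ≤ i ≤ n−t−1; T^{m k_{n−t}} < |u_{n−t}| ≤ γ^{−m} λ^t T^{m k_{n−t}}; |u_i| ≤ λ^{−1} T^{m k_i} for n−t+1 ≤ i ≤ n; and max_{1≤j≤m} |Θ*_j(u) − v_j| ≤ γ T^{−1}. In particular max_{1≤i≤n} |u_i|^{1/(m k_i)} = |u_{n−t}|^{1/(m k_{n−t})}. -/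

import Mathlib

open Real MeasureTheory Topology

/-- Distance from a real number to the nearest integer. -/
noncomputable def distNearestInt (y : ℝ) : ℝ := ⨅ p : ℤ, |y - (p : ℝ)|

/-- `Θᵢ(q) = ∑ⱼ qⱼ Θᵢⱼ` : the `i`-th linear form of `Θ` evaluated at `q ∈ ℤᵐ`. -/
noncomputable def linForm {n m : ℕ} (Θ : Matrix (Fin n) (Fin m) ℝ) (q : Fin m → ℤ)
    (i : Fin n) : ℝ := ∑ j, (q j : ℝ) * Θ i j

/-- `Θ*ⱼ(u) = ∑ᵢ uᵢ Θᵢⱼ` : the `j`-th linear form of the transposed matrix `Θ*`. -/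
noncomputable def dualForm {n m : ℕ} (Θ : Matrix (Fin n) (Fin m) ℝ) (u : Fin n → ℤ)
    (j : Fin m) : ℝ := ∑ i, (u i : ℝ) * Θ i j

/-- The supremum norm `|q|` of an integer vector. -/
noncomputable def supNorm {m : ℕ} (q : Fin m → ℤ) : ℝ := ⨆ j, |(q j : ℝ)|

/-- A weight vector: positive entries summing to 1. -/
def IsWeight {n : ℕ} (k : Fin n → ℝ) : Prop := (∀ i, 0 < k i) ∧ ∑ i, k i = 1

/-- The set `Bad(k,n,m)` of weighted badly approximable `n × m` matrices:
`inf_{q ∈ ℤᵐ, q ≠ 0} max_{1≤i≤n} |q|^{m kᵢ} ‖Θᵢ(q)‖ > 0`. -/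
def Bad (n m : ℕ) (k : Fin n → ℝ) : Set (Matrix (Fin n) (Fin m) ℝ) :=
  {Θ | ∃ c > 0, ∀ q : Fin m → ℤ, q ≠ 0 →
    c ≤ ⨆ i, supNorm q ^ ((m : ℝ) * k i) * distNearestInt (linForm Θ q i)}

/-- The twisted set `Bad_Θ(k,n,m)`:
`{x ∈ ℝⁿ : inf_{q ∈ ℤᵐ, q ≠ 0} max_{1≤i≤n} |q|^{m kᵢ} ‖Θᵢ(q) − xᵢ‖ > 0}`. -/
def BadT (n m : ℕ) (k : Fin n → ℝ) (Θ : Matrix (Fin n) (Fin m) ℝ) : Set (Fin n → ℝ) :=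
  {x | ∃ c > 0, ∀ q : Fin m → ℤ, q ≠ 0 →
    c ≤ ⨆ i, supNorm q ^ ((m : ℝ) * k i) * distNearestInt (linForm Θ q i - x i)}

/-- **Minkowski's linear forms theorem**. -/
theorem exists_int_ne_zero_abs_mulVec_le {ι : Type*} [Fintype ι] [DecidableEq ι] [Nonempty ι]
    (A : Matrix ι ι ℝ) (hA : A.det ≠ 0) (c : ι → ℝ) (hc : ∀ i, 0 ≤ c i)
    (h : |A.det| ≤ ∏ i, c i) :
    ∃ x : ι → ℤ, x ≠ 0 ∧ ∀ i, |(A.mulVec fun j => (x j : ℝ)) i| ≤ c i := by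
  classical
  set f : (ι → ℝ) →ₗ[ℝ] (ι → ℝ) := Matrix.toLin' A with hf
  have hdet : LinearMap.det f = A.det := LinearMap.det_toLin' A
  have hdet0 : LinearMap.det f ≠ 0 := by rwa [hdet]
  set b := Pi.basisFun ℝ ι
  set L := (Submodule.span ℤ (Set.range b)).toAddSubgroup
  have hcount : Countable L :=
    inferInstanceAs (Countable (Submodule.span ℤ (Set.range b)))
  set s : Set (ι → ℝ) := f ⁻¹' Set.Icc (-c) c with hs
  have hfund := ZSpan.isAddFundamentalDomain' b volume
  have hsymm : ∀ x ∈ s, -x ∈ s := by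
    rintro x ⟨h1, h2⟩
    refine ⟨?_, ?_⟩
    · rw [map_neg]; exact neg_le_neg h2
    · rw [map_neg]; exact neg_le.mp h1
  have hconv : Convex ℝ s := (convex_Icc (-c) c).linear_preimage f
  have hcpt : IsCompact s :=
    (f.equivOfDetNeZero hdet0).toContinuousLinearEquiv.toHomeomorph.isCompact_preimage.mpr
      isCompact_Icc
  have hvol : volume (ZSpan.fundamentalDomain b) * 2 ^ Module.finrank ℝ (ι → ℝ) ≤ volume s := by
    rw [hs, Measure.addHaar_preimage_linearMap volume hdet0, Real.volume_Icc_pi, hdet,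
      ZSpan.fundamentalDomain_pi_basisFun, volume_pi_pi, Module.finrank_fintype_fun_eq_card,
      ← ENNReal.ofReal_prod_of_nonneg (fun i _ => by simpa using hc i),
      ← ENNReal.ofReal_mul (abs_nonneg _)]
    have h2 : ∏ i, (c i - (-c) i) = 2 ^ Fintype.card ι * ∏ i, c i := by
      rw [← Finset.card_univ, ← Finset.prod_const, ← Finset.prod_mul_distrib]
      exact Finset.prod_congr rfl fun i _ => by simp; ring
    have h3 : (2 : ℝ) ^ Fintype.card ι ≤ |A.det⁻¹| * (2 ^ Fintype.card ι * ∏ i, c i) := by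
      rw [abs_inv, inv_mul_eq_div, le_div_iff₀ (abs_pos.mpr hA)]
      gcongr
    rw [h2]
    calc _ = ENNReal.ofReal ((2 : ℝ) ^ Fintype.card ι) := by
          simp [ENNReal.ofReal_pow]
      _ ≤ _ := ENNReal.ofReal_le_ofReal h3
  obtain ⟨⟨x, hxL⟩, hx0, hxs⟩ :=
    exists_ne_zero_mem_lattice_of_measure_mul_two_pow_le_measure (L := L) hfund hsymm hconv hcpt
      hvol
  choose y hy using (b.mem_span_iff_repr_mem ℤ x).mp hxL
  have hyx : (fun j => (y j : ℝ)) = x := funext fun j => by simpa [b] using hy j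
  refine ⟨y, ?_, fun i => ?_⟩
  · rintro rfl
    exact hx0 (Subtype.ext (by simpa [funext_iff, eq_comm] using hyx))
  · rw [hyx]
    exact abs_le.mpr ⟨hxs.1 i, hxs.2 i⟩

/-- Minkowski's linear forms theorem for the system `u`, `Θ* u - v`. -/
theorem exists_int_ne_zero_abs_dualForm_sub_le {n m : ℕ} (hm : 0 < m)
    (Θ : Matrix (Fin n) (Fin m) ℝ) (c : Fin n → ℝ) (d : Fin m → ℝ) (hc : ∀ i, 0 ≤ c i)
    (hd : ∀ j, 0 ≤ d j) (h : 1 ≤ (∏ i, c i) * ∏ j, d j) :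
    ∃ u : Fin n → ℤ, ∃ v : Fin m → ℤ, (u ≠ 0 ∨ v ≠ 0) ∧
      (∀ i, (|u i| : ℝ) ≤ c i) ∧ ∀ j, |dualForm Θ u j - v j| ≤ d j := by
  have : Nonempty (Fin m) := ⟨⟨0, hm⟩⟩
  have hdet : (Matrix.fromBlocks 1 0 Θ.transpose (-1) :
      Matrix (Fin n ⊕ Fin m) (Fin n ⊕ Fin m) ℝ).det = (-1) ^ m := by
    simp [Matrix.det_fromBlocks_zero₁₂, Matrix.det_neg]
  obtain ⟨x, hx0, hx⟩ := exists_int_ne_zero_abs_mulVec_le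
    (Matrix.fromBlocks 1 0 Θ.transpose (-1)) (by simp [hdet]) (Sum.elim c d)
    (by rintro (i | j) <;> simp [hc, hd]) (by simpa [hdet, abs_pow] using h)
  refine ⟨fun i => x (Sum.inl i), fun j => x (Sum.inr j), ?_, fun i => ?_, fun j => ?_⟩
  · by_contra! hcon
    refine hx0 (funext ?_)
    rintro (i | j)
    · exact congrFun hcon.1 i
    · exact congrFun hcon.2 j
  · simpa [Matrix.fromBlocks_mulVec, Function.comp_def] using hx (Sum.inl i)
  · simpa [dualForm, Matrix.mulVec, dotProduct, Fintype.sum_sum_type, Matrix.one_apply,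
      sub_eq_add_neg, mul_comm] using hx (Sum.inr j)

theorem distNearestInt_le (y : ℝ) (p : ℤ) : distNearestInt y ≤ |y - p| :=
  ciInf_le ⟨0, by rintro _ ⟨p, rfl⟩; exact abs_nonneg _⟩ p

theorem distNearestInt_nonneg (y : ℝ) : 0 ≤ distNearestInt y :=
  le_ciInf fun _ => abs_nonneg _

/-- (Construction of the vectors `w(T) = (u(T),v(T))` in §4.4.)
Under the dual badly approximable condition with constant `γ`, for every `T ≥ 1`
there is `(u,v) ∈ ℤⁿ × ℤᵐ` lying in the large parallelepiped but outside the small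
one: `|uᵢ| ≤ T^{m kᵢ}` for `1 ≤ i ≤ n−t−1`,
`T^{m k_{n−t}} < |u_{n−t}| ≤ γ^{−m} λᵗ T^{m k_{n−t}}`, `|uᵢ| ≤ λ^{−1} T^{m kᵢ}` for
`n−t+1 ≤ i ≤ n`, `max_j |Θ*ⱼ(u) − vⱼ| ≤ γ T^{−1}`; in particular
`max_i |uᵢ|^{1/(m kᵢ)} = |u_{n−t}|^{1/(m k_{n−t})}`.
(`i₀` is the 0-based index of the coordinate `u_{n−t}`.) -/
theorem construction_of_uT {n m : ℕ} (hm : 0 < m)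
    (k : Fin n → ℝ) (hk : IsWeight k)
    (hsort : ∀ i j : Fin n, i ≤ j → k j ≤ k i)
    (t : ℕ) (ht : 1 ≤ t) (htn : t ≤ n - 1)
    (lam γ : ℝ) (hlam : 1 ≤ lam) (hγ0 : 0 < γ) (hγ1 : γ < 1)
    (Θ : Matrix (Fin n) (Fin m) ℝ)
    (hdual : ∀ u : Fin n → ℤ, u ≠ 0 →
      γ < (⨆ i, |(u i : ℝ)| ^ (1 / ((m : ℝ) * k i))) *
        ⨆ j, distNearestInt (dualForm Θ u j))
    (i₀ : Fin n) (hi₀ : (i₀ : ℕ) = n - t - 1)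
    (T : ℝ) (hT : 1 ≤ T) :
    ∃ u : Fin n → ℤ, ∃ v : Fin m → ℤ,
      (∀ i : Fin n, (i : ℕ) < n - t - 1 → (|u i| : ℝ) ≤ T ^ ((m : ℝ) * k i)) ∧
      T ^ ((m : ℝ) * k i₀) < (|u i₀| : ℝ) ∧
      (|u i₀| : ℝ) ≤ (γ ^ m)⁻¹ * lam ^ t * T ^ ((m : ℝ) * k i₀) ∧
      (∀ i : Fin n, n - t ≤ (i : ℕ) → (|u i| : ℝ) ≤ lam⁻¹ * T ^ ((m : ℝ) * k i)) ∧
      (∀ j, |dualForm Θ u j - v j| ≤ γ / T) ∧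
      (⨆ i, |(u i : ℝ)| ^ (1 / ((m : ℝ) * k i))) = (|u i₀| : ℝ) ^ (1 / ((m : ℝ) * k i₀)) := by
  have hT0 : 0 < T := one_pos.trans_le hT
  have hlam0 : 0 < lam := one_pos.trans_le hlam
  have hmR : (0 : ℝ) < m := by exact_mod_cast hm
  have hmk : ∀ i, 0 < (m : ℝ) * k i := fun i => mul_pos hmR (hk.1 i)
  have hTpos : ∀ i, 0 < T ^ ((m : ℝ) * k i) := fun i => Real.rpow_pos_of_pos hT0 _
  have hroot : ∀ (i : Fin n) {a : ℝ}, 0 ≤ a →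
      (a ^ (1 / ((m : ℝ) * k i)) ≤ T ↔ a ≤ T ^ ((m : ℝ) * k i)) := fun i a ha => by
    rw [one_div]
    exact Real.rpow_inv_le_iff_of_pos ha hT0.le (hmk i)
  have hne : Nonempty (Fin n) := ⟨i₀⟩
  have hnem : Nonempty (Fin m) := ⟨⟨0, hm⟩⟩
  set c : Fin n → ℝ := fun i => (if i = i₀ then (γ ^ m)⁻¹ * lam ^ t else 1) *
    (if i₀ < i then lam⁻¹ else 1) * T ^ ((m : ℝ) * k i) with hc
  have hc0 : ∀ i, 0 ≤ c i := fun i => by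
    simp only [hc]
    split_ifs <;> have := hTpos i <;> positivity
  have hcprod : (∏ i, c i) * ∏ _j : Fin m, γ / T = 1 := by
    have hcard : (Finset.univ.filter fun i => i₀ < i).card = t := by
      rw [Finset.filter_lt_eq_Ioi, Fin.card_Ioi]
      omega
    have hTprod : ∏ i, T ^ ((m : ℝ) * k i) = T ^ m := by
      rw [← Real.rpow_sum_of_pos hT0, ← Finset.mul_sum, hk.2, mul_one, Real.rpow_natCast]
    simp only [hc, Finset.prod_mul_distrib, hTprod, Finset.prod_ite_eq', Finset.mem_univ, if_true,
      Finset.prod_const, Finset.card_univ, Fintype.card_fin, ← Finset.prod_filter, hcard, div_pow,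
      inv_pow]
    field_simp
  obtain ⟨u, v, huv, hu, hv⟩ := exists_int_ne_zero_abs_dualForm_sub_le hm Θ c (fun _ => γ / T) hc0
    (fun _ => by positivity) hcprod.ge
  have hγT : γ / T < 1 := (div_lt_one hT0).mpr (hγ1.trans_le hT)
  have hu0 : u ≠ 0 := by
    rintro rfl
    refine huv.elim (fun h => h rfl) fun h => h (funext fun j => ?_)
    have hj := (hv j).trans_lt hγT
    simp only [dualForm, Pi.zero_apply, Int.cast_zero, zero_mul, Finset.sum_const_zero, zero_sub,
      abs_neg] at hj
    exact Int.abs_lt_one_iff.mp (by exact_mod_cast hj)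
  have hlt : ∀ i : Fin n, i < i₀ → (|u i| : ℝ) ≤ T ^ ((m : ℝ) * k i) := fun i hi => by
    simpa [hc, hi.ne, hi.not_gt] using hu i
  have hgt : ∀ i : Fin n, i₀ < i → (|u i| : ℝ) ≤ lam⁻¹ * T ^ ((m : ℝ) * k i) := fun i hi => by
    simpa [hc, hi.ne', hi] using hu i
  have hne_le : ∀ i : Fin n, i ≠ i₀ → |(u i : ℝ)| ^ (1 / ((m : ℝ) * k i)) ≤ T := fun i hi => by
    rw [hroot i (abs_nonneg _)]
    rcases hi.lt_or_gt with hi | hi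
    · exact hlt i hi
    · exact (hgt i hi).trans (mul_le_of_le_one_left (hTpos i).le (inv_le_one_of_one_le₀ hlam))
  have hT_lt : T < |(u i₀ : ℝ)| ^ (1 / ((m : ℝ) * k i₀)) := by
    by_contra! hle
    refine (hdual u hu0).not_ge ?_
    have h1 : (⨆ i, |(u i : ℝ)| ^ (1 / ((m : ℝ) * k i))) ≤ T := ciSup_le fun i => by
      rcases eq_or_ne i i₀ with rfl | hi
      · exact hle
      · exact hne_le i hi
    have h2 : (⨆ j, distNearestInt (dualForm Θ u j)) ≤ γ / T :=
      ciSup_le fun j => (distNearestInt_le _ (v j)).trans (hv j)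
    calc _ ≤ T * (γ / T) :=
          mul_le_mul h1 h2 (Real.iSup_nonneg fun j => distNearestInt_nonneg _) hT0.le
      _ = γ := mul_div_cancel₀ γ hT0.ne'
  refine ⟨u, v, fun i hi => hlt i (Fin.lt_def.mpr (hi₀ ▸ hi)), ?_, ?_,
    fun i hi => hgt i (Fin.lt_def.mpr (by omega)), hv, ?_⟩
  · exact not_le.mp fun hle => hT_lt.not_ge ((hroot i₀ (abs_nonneg _)).mpr hle)
  · simpa [hc] using hu i₀
  · refine le_antisymm (ciSup_le fun i => ?_)
      (le_ciSup (f := fun i => |(u i : ℝ)| ^ (1 / ((m : ℝ) * k i))) (Set.finite_range _).bddAbove i₀)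
    rcases eq_or_ne i i₀ with rfl | hi
    · exact le_rfl
    · exact (hne_le i hi).trans hT_lt.le
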